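/- Let n ≥ 1 and let L be an n×n real upper bidiagonal matrix with positive entries L_{kk} (k=1,…,n) on the main diagonal and L_{k,k+1} (k=1,…,n−1) on the superdiagonal. Let A be the 2n×2n block matrix [[0, Lᵀ],[L, 0]]. Let P be the 2n×2n perfect shuffle permutation matrix with P_{ij}=1 iff j=2i−1 (for 1≤i≤n) or j=2(i−n) (for n+1≤i≤2n), and let D be the 2n×2n diagonal matrix with (i,i) entry n^{−(i−1)/2} ∏_{k=1}^{⌊i/2⌋} L_{kk} ∏_{k=1}^{⌊(i−1)/2⌋} L_{k,k+1}. Then D Pᵀ A P D^{−1} is tridiagonal with zero main diagonal, every superdiagonal entry equal to √n, and subdiagonal entries given by (2j, 2j−1) entry = L_{jj}²/√n for j=1,…,n and (2j+1, 2j) entry = L_{j,j+1}²/√n for j=1,…,n−1. -/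

import Mathlib

open Matrix Real Finset

namespace PerfectShuffle

/-- The perfect shuffle on indices: even positions go to the first block, odd positions to the
second one. -/
def shuffle {n : ℕ} (i : Fin (2 * n)) : Fin n ⊕ Fin n :=
  if (i : ℕ) % 2 = 0 then Sum.inl ⟨i / 2, by omega⟩ else Sum.inr ⟨i / 2, by omega⟩

lemma shuffle_even {n k : ℕ} (h : 2 * k < 2 * n) :
    shuffle (⟨2 * k, h⟩ : Fin (2 * n)) = Sum.inl ⟨k, by omega⟩ := by
  simp [shuffle]

lemma shuffle_odd {n k : ℕ} (h : 2 * k + 1 < 2 * n) :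
    shuffle (⟨2 * k + 1, h⟩ : Fin (2 * n)) = Sum.inr ⟨k, by omega⟩ := by
  have h1 : (2 * k + 1) % 2 = 1 := by omega
  have h2 : (2 * k + 1) / 2 = k := by omega
  simp [shuffle, h1, h2]

lemma shuffle_even_succ {n k : ℕ} (h : 2 * k + 2 < 2 * n) :
    shuffle (⟨2 * k + 2, h⟩ : Fin (2 * n)) = Sum.inl ⟨k + 1, by omega⟩ :=
  shuffle_even (k := k + 1) h

lemma fin_two_mul_cases {n : ℕ} (i : Fin (2 * n)) :
    (∃ (k : ℕ) (h : 2 * k < 2 * n), i = ⟨2 * k, h⟩) ∨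
      ∃ (k : ℕ) (h : 2 * k + 1 < 2 * n), i = ⟨2 * k + 1, h⟩ := by
  obtain ⟨i, hi⟩ := i
  obtain ⟨k, rfl | rfl⟩ := Nat.even_or_odd' i
  · exact Or.inl ⟨k, hi, rfl⟩
  · exact Or.inr ⟨k, hi, rfl⟩

/-- Conjugating a reindexed block matrix by the perfect shuffle permutation matrix. -/
lemma transpose_mul_reindex_mul {n : ℕ} (M : Matrix (Fin n ⊕ Fin n) (Fin n ⊕ Fin n) ℝ)
    {P : Matrix (Fin (2 * n)) (Fin (2 * n)) ℝ}
    (hP : P = Matrix.of fun (i j : Fin (2 * n)) =>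
      if ((i : ℕ) < n ∧ (j : ℕ) = 2 * (i : ℕ)) ∨
          (n ≤ (i : ℕ) ∧ (j : ℕ) = 2 * ((i : ℕ) - n) + 1) then 1 else 0) :
    Pᵀ * Matrix.reindex (finSumFinEquiv.trans (finCongr (two_mul n).symm))
      (finSumFinEquiv.trans (finCongr (two_mul n).symm)) M * P = M.submatrix shuffle shuffle := by
  set e := (finSumFinEquiv (m := n) (n := n)).trans (finCongr (two_mul n).symm) with he
  have key : P = (1 : Matrix (Fin (2 * n)) (Fin (2 * n)) ℝ).submatrix id (e ∘ shuffle) := by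
    rw [hP]
    ext i j
    simp only [of_apply, submatrix_apply, id, one_apply, Function.comp_apply]
    congr 1
    rw [eq_iff_iff, Fin.ext_iff]
    obtain ⟨k, h, rfl⟩ | ⟨k, h, rfl⟩ := fin_two_mul_cases j
    · rw [shuffle_even]
      simp [he]
      omega
    · rw [shuffle_odd]
      simp [he]
      omega
  ext i j
  rw [key]
  simp [Matrix.mul_apply, one_apply]

/-- The diagonal entries of the conjugating matrix, in terms of total functions on `ℕ`. -/
noncomputable def weight (n : ℕ) (a b : ℕ → ℝ) (i : ℕ) : ℝ :=
  (n : ℝ) ^ (-(i : ℝ) / 2) * (∏ k ∈ Finset.range ((i + 1) / 2), a k) *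
    ∏ k ∈ Finset.range (i / 2), b k

lemma rpow_neg_succ_half {x : ℝ} (hx : 0 < x) (i : ℕ) :
    x ^ (-((i + 1 : ℕ) : ℝ) / 2) = x ^ (-(i : ℝ) / 2) / √x := by
  rw [Real.sqrt_eq_rpow, ← Real.rpow_sub hx]
  congr 1
  push_cast
  ring

lemma weight_odd {n : ℕ} (hn : 1 ≤ n) (a b : ℕ → ℝ) (k : ℕ) :
    weight n a b (2 * k + 1) = weight n a b (2 * k) * (a k / √n) := by
  have h1 : (2 * k + 1 + 1) / 2 = k + 1 := by omega
  have h2 : (2 * k + 1) / 2 = k := by omega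
  have h3 : 2 * k / 2 = k := by omega
  simp only [weight, h1, h2, h3, rpow_neg_succ_half (Nat.cast_pos.2 hn : (0 : ℝ) < n),
    Finset.prod_range_succ]
  ring

lemma weight_even {n : ℕ} (hn : 1 ≤ n) (a b : ℕ → ℝ) (k : ℕ) :
    weight n a b (2 * k + 2) = weight n a b (2 * k + 1) * (b k / √n) := by
  have h1 : (2 * k + 1 + 1) / 2 = k + 1 := by omega
  have h2 : (2 * k + 1) / 2 = k := by omega
  have h3 : (2 * k + 1 + 1 + 1) / 2 = k + 1 := by omega
  rw [show 2 * k + 2 = 2 * k + 1 + 1 from rfl]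
  simp only [weight, h1, h2, h3, rpow_neg_succ_half (Nat.cast_pos.2 hn : (0 : ℝ) < n) (2 * k + 1),
    Finset.prod_range_succ b]
  ring

lemma weight_pos {n : ℕ} (hn : 1 ≤ n) {a b : ℕ → ℝ} (ha : ∀ k, 0 < a k) (hb : ∀ k, 0 < b k)
    (i : ℕ) : 0 < weight n a b i := by
  have : (0 : ℝ) < n := Nat.cast_pos.2 hn
  exact mul_pos (mul_pos (Real.rpow_pos_of_pos this _) (Finset.prod_pos fun k _ => ha k))
    (Finset.prod_pos fun k _ => hb k)

lemma diagonal_mul_mul_inv_apply {m : Type*} [Fintype m] [DecidableEq m] {d : m → ℝ}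
    (hd : ∀ i, d i ≠ 0) (M : Matrix m m ℝ) (i j : m) :
    (diagonal d * M * (diagonal d)⁻¹) i j = d i * M i j / d j := by
  have h : (diagonal d)⁻¹ = diagonal fun i => (d i)⁻¹ := by
    refine inv_eq_right_inv ?_
    rw [diagonal_mul_diagonal, ← diagonal_one]
    congr 1
    ext i
    exact mul_inv_cancel₀ (hd i)
  rw [h, mul_diagonal, diagonal_mul, div_eq_mul_inv]

end PerfectShuffle

/-- the perfect-shuffle identity underlying the square Laguerre
matrix model at the soft edge: for an upper bidiagonal `L` with positive
bidiagonal entries, `D Pᵀ [[0,Lᵀ],[L,0]] P D⁻¹` is tridiagonal with zero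
diagonal, superdiagonal entries `√n`, and subdiagonal entries
`L_{jj}²/√n` at `(2j,2j−1)` and `L_{j,j+1}²/√n` at `(2j+1,2j)`
(1-based indexing in this description). -/
theorem laguerre_square_perfect_shuffle (n : ℕ) (hn : 1 ≤ n)
    (L : Matrix (Fin n) (Fin n) ℝ)
    (hLbd : ∀ i j : Fin n, (j : ℕ) ≠ (i : ℕ) → (j : ℕ) ≠ (i : ℕ) + 1 → L i j = 0)
    (hLdiag : ∀ i : Fin n, 0 < L i i)
    (hLsuper : ∀ i j : Fin n, (j : ℕ) = (i : ℕ) + 1 → 0 < L i j)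
    (A : Matrix (Fin (2 * n)) (Fin (2 * n)) ℝ)
    (hA : A = Matrix.reindex (finSumFinEquiv.trans (finCongr (two_mul n).symm))
      (finSumFinEquiv.trans (finCongr (two_mul n).symm))
      (Matrix.fromBlocks 0 Lᵀ L 0))
    (P : Matrix (Fin (2 * n)) (Fin (2 * n)) ℝ)
    (hP : P = Matrix.of fun (i j : Fin (2 * n)) =>
      if ((i : ℕ) < n ∧ (j : ℕ) = 2 * (i : ℕ)) ∨
          (n ≤ (i : ℕ) ∧ (j : ℕ) = 2 * ((i : ℕ) - n) + 1) then 1 else 0)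
    (D : Matrix (Fin (2 * n)) (Fin (2 * n)) ℝ)
    (hD : D = Matrix.diagonal (fun i : Fin (2 * n) =>
      (n : ℝ) ^ (-(((i : ℕ) : ℝ)) / 2) *
        (∏ k ∈ (Finset.range (((i : ℕ) + 1) / 2)).attach,
          L ⟨k.1, by have := Finset.mem_range.mp k.2; have := i.isLt; omega⟩
            ⟨k.1, by have := Finset.mem_range.mp k.2; have := i.isLt; omega⟩) *
        (∏ k ∈ (Finset.range ((i : ℕ) / 2)).attach,
          L ⟨k.1, by have := Finset.mem_range.mp k.2; have := i.isLt; omega⟩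
            ⟨k.1 + 1, by have := Finset.mem_range.mp k.2; have := i.isLt; omega⟩))) :
    (∀ i j : Fin (2 * n), (i : ℕ) + 1 < (j : ℕ) ∨ (j : ℕ) + 1 < (i : ℕ) →
      (D * Pᵀ * A * P * D⁻¹) i j = 0) ∧
    (∀ i : Fin (2 * n), (D * Pᵀ * A * P * D⁻¹) i i = 0) ∧
    (∀ i j : Fin (2 * n), (j : ℕ) = (i : ℕ) + 1 →
      (D * Pᵀ * A * P * D⁻¹) i j = Real.sqrt n) ∧
    (∀ j : Fin n,
      (D * Pᵀ * A * P * D⁻¹) ⟨2 * (j : ℕ) + 1, by have := j.isLt; omega⟩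
          ⟨2 * (j : ℕ), by have := j.isLt; omega⟩
        = (L j j) ^ 2 / Real.sqrt n) ∧
    (∀ j : Fin n, ∀ hj : (j : ℕ) + 1 < n,
      (D * Pᵀ * A * P * D⁻¹) ⟨2 * (j : ℕ) + 2, by omega⟩
          ⟨2 * (j : ℕ) + 1, by omega⟩
        = (L j ⟨(j : ℕ) + 1, hj⟩) ^ 2 / Real.sqrt n) := by
  set a : ℕ → ℝ := fun k => if h : k < n then L ⟨k, h⟩ ⟨k, h⟩ else 1 with ha
  set b : ℕ → ℝ := fun k =>
    if h : k + 1 < n then L ⟨k, by omega⟩ ⟨k + 1, h⟩ else 1 with hb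
  have a_eq (k : ℕ) (h : k < n) : L ⟨k, h⟩ ⟨k, h⟩ = a k := by simp [ha, h]
  have b_eq (k : ℕ) (h : k + 1 < n) : L ⟨k, by omega⟩ ⟨k + 1, h⟩ = b k := by simp [hb, h]
  have a_pos (k : ℕ) : 0 < a k := by
    by_cases h : k < n
    · rw [← a_eq k h]
      exact hLdiag _
    · simp [ha, h]
  have b_pos (k : ℕ) : 0 < b k := by
    by_cases h : k + 1 < n
    · rw [← b_eq k h]
      exact hLsuper _ _ rfl
    · simp [hb, h]
  have hD' : D = diagonal fun i : Fin (2 * n) => PerfectShuffle.weight n a b i := by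
    rw [hD]
    congr 1
    ext i
    rw [PerfectShuffle.weight, ← Finset.prod_attach _ a, ← Finset.prod_attach _ b]
    congr 1
    · congr 1
      exact Finset.prod_congr rfl fun k _ => a_eq _ _
    · exact Finset.prod_congr rfl fun k _ => b_eq _ _
  have w_pos := PerfectShuffle.weight_pos hn a_pos b_pos
  have entry (i j : Fin (2 * n)) : (D * Pᵀ * A * P * D⁻¹) i j =
      PerfectShuffle.weight n a b i *
        fromBlocks 0 Lᵀ L 0 (PerfectShuffle.shuffle i) (PerfectShuffle.shuffle j) /
          PerfectShuffle.weight n a b j := by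
    rw [Matrix.mul_assoc D, Matrix.mul_assoc D, hA,
      PerfectShuffle.transpose_mul_reindex_mul _ hP, hD',
      PerfectShuffle.diagonal_mul_mul_inv_apply fun i : Fin (2 * n) => (w_pos i).ne']
    rfl
  refine ⟨fun i j hij => ?_, fun i => ?_, fun i j hij => ?_, fun j => ?_, fun j hj => ?_⟩
  · rw [entry]
    obtain ⟨k, h, rfl⟩ | ⟨k, h, rfl⟩ := PerfectShuffle.fin_two_mul_cases i <;>
    obtain ⟨l, h', rfl⟩ | ⟨l, h', rfl⟩ := PerfectShuffle.fin_two_mul_cases j <;>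
    dsimp only at hij
    · simp [PerfectShuffle.shuffle_even]
    · have := hLbd ⟨l, by omega⟩ ⟨k, by omega⟩ (by dsimp only; omega) (by dsimp only; omega)
      simp [PerfectShuffle.shuffle_even, PerfectShuffle.shuffle_odd, this]
    · have := hLbd ⟨k, by omega⟩ ⟨l, by omega⟩ (by dsimp only; omega) (by dsimp only; omega)
      simp [PerfectShuffle.shuffle_even, PerfectShuffle.shuffle_odd, this]
    · simp [PerfectShuffle.shuffle_odd]
  · rw [entry]
    obtain ⟨k, h, rfl⟩ | ⟨k, h, rfl⟩ := PerfectShuffle.fin_two_mul_cases i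
    · simp [PerfectShuffle.shuffle_even]
    · simp [PerfectShuffle.shuffle_odd]
  · rw [entry]
    obtain ⟨j, hj⟩ := j
    obtain ⟨k, h, rfl⟩ | ⟨k, h, rfl⟩ := PerfectShuffle.fin_two_mul_cases i <;>
    dsimp only at hij <;> subst hij
    · rw [PerfectShuffle.shuffle_even, PerfectShuffle.shuffle_odd, fromBlocks_apply₁₂,
        transpose_apply, a_eq, PerfectShuffle.weight_odd hn]
      have := (w_pos (2 * k)).ne'
      have := (a_pos k).ne'
      field_simp
    · rw [PerfectShuffle.shuffle_odd, PerfectShuffle.shuffle_even_succ,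
        fromBlocks_apply₂₁, b_eq, PerfectShuffle.weight_even hn]
      have := (w_pos (2 * k + 1)).ne'
      have := (b_pos k).ne'
      field_simp
  · rw [entry, PerfectShuffle.shuffle_odd, PerfectShuffle.shuffle_even, fromBlocks_apply₂₁,
      PerfectShuffle.weight_odd hn, a_eq j j.isLt]
    have := (w_pos (2 * j)).ne'
    field_simp
  · rw [entry, PerfectShuffle.shuffle_odd, PerfectShuffle.shuffle_even_succ,
      fromBlocks_apply₁₂, transpose_apply, PerfectShuffle.weight_even hn, b_eq j hj]
    have := (w_pos (2 * j + 1)).ne'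
    field_simp
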